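/- Consider on $\Sigma = \mathbb{C}^2 \setminus \{0\}$ the bivector $\pi_{\Sigma} = \tfrac14 (\mathscr{E}_0 - \mathscr{E}_1) \wedge (\mathscr{V}_0 - \mathscr{V}_1)$ where $\mathscr{E}_i = x_i\partial_{x_i} + y_i\partial_{y_i}$, $\mathscr{V}_i = x_i\partial_{y_i} - y_i\partial_{x_i}$. Then $\pi_{\Sigma}$ is invariant under the scalar $\mathbb{C}^{\times}$-action $w\cdot(z_0,z_1) = (wz_0, wz_1)$, and at a point $(z_0, z_1)$: the intersection of the image of $\pi_{\Sigma}^{\sharp}$ with the vertical space $V = \mathrm{span}(\mathscr{E}_0+\mathscr{E}_1, \mathscr{V}_0+\mathscr{V}_1)$ of the projection to $\mathbb{C}P^1$ is zero if $z_0 z_1 \neq 0$, while if exactly one of $z_0, z_1$ is zero, the image of $\pi_{\Sigma}^{\sharp}$ equals $V$. -/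

import Mathlib

noncomputable section

/-- `𝓔₀ - 𝓔₁` at `z = (x₀,y₀,x₁,y₁)`. -/
def ee (z : Fin 4 → ℝ) : Fin 4 → ℝ := ![z 0, z 1, -(z 2), -(z 3)]

/-- `𝓥₀ - 𝓥₁` at `z`. -/
def vv (z : Fin 4 → ℝ) : Fin 4 → ℝ := ![-(z 1), z 0, z 3, -(z 2)]

/-- `𝓔₀ + 𝓔₁` at `z` (vertical generator of the projection to `ℂP¹`). -/
def Ep (z : Fin 4 → ℝ) : Fin 4 → ℝ := z

/-- `𝓥₀ + 𝓥₁` at `z` (vertical generator of the projection to `ℂP¹`). -/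
def Vp (z : Fin 4 → ℝ) : Fin 4 → ℝ := ![-(z 1), z 0, -(z 3), z 2]

/-- The (real-linear) action of `w = a + bi ∈ ℂˣ` on `ℂ² = ℝ⁴` by scalar multiplication. -/
def Aw (a b : ℝ) (z : Fin 4 → ℝ) : Fin 4 → ℝ :=
  ![a * z 0 - b * z 1, b * z 0 + a * z 1, a * z 2 - b * z 3, b * z 2 + a * z 3]

/-- The image of `π_Σ^♯` at `z`, for `π_Σ = ¼ (𝓔₀-𝓔₁)∧(𝓥₀-𝓥₁)`:
`π_Σ^♯(ξ) = ¼ ξ(𝓔₀-𝓔₁)(𝓥₀-𝓥₁) - ¼ ξ(𝓥₀-𝓥₁)(𝓔₀-𝓔₁)`. -/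
def sharpIm (z : Fin 4 → ℝ) : Set (Fin 4 → ℝ) :=
  {u | ∃ ξ : (Fin 4 → ℝ) →ₗ[ℝ] ℝ,
    u = ((1/4) * ξ (ee z)) • vv z - ((1/4) * ξ (vv z)) • ee z}

/-- The vertical space `V = span(𝓔₀+𝓔₁, 𝓥₀+𝓥₁)` at `z`. -/
def vert (z : Fin 4 → ℝ) : Set (Fin 4 → ℝ) :=
  {u | ∃ c d : ℝ, u = c • Ep z + d • Vp z}

/-- The image of `π_Σ^♯` away from the origin is the real span of `𝓔₀ - 𝓔₁` and `𝓥₀ - 𝓥₁`. -/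
theorem mem_sharpIm_iff {z : Fin 4 → ℝ} (hz : z ≠ 0) (u : Fin 4 → ℝ) :
    u ∈ sharpIm z ↔ ∃ α β : ℝ, u = α • ee z + β • vv z := by
  constructor
  · rintro ⟨ξ, rfl⟩
    exact ⟨-((1/4) * ξ (vv z)), (1/4) * ξ (ee z), by module⟩
  · rintro ⟨α, β, rfl⟩
    have hN : z ⬝ᵥ z ≠ 0 := fun h => hz (dotProduct_self_eq_zero.mp h)
    have hee : ee z ⬝ᵥ ee z = z ⬝ᵥ z := by
      simp [dotProduct, Fin.sum_univ_four, ee]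
    have hvv : vv z ⬝ᵥ vv z = z ⬝ᵥ z := by
      simp [dotProduct, Fin.sum_univ_four, vv]; ring
    have hev : ee z ⬝ᵥ vv z = 0 := by
      simp [dotProduct, Fin.sum_univ_four, ee, vv]; ring
    let ξ : (Fin 4 → ℝ) →ₗ[ℝ] ℝ :=
      (4 / (z ⬝ᵥ z)) • dotProductBilin ℝ ℝ (β • ee z - α • vv z)
    have h₁ : ξ (ee z) = 4 * β := by
      simp [ξ, dotProductBilin, sub_dotProduct, hee, dotProduct_comm (vv z), hev]
      field_simp
    have h₂ : ξ (vv z) = -(4 * α) := by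
      simp [ξ, dotProductBilin, sub_dotProduct, hvv, hev]
      field_simp
    refine ⟨ξ, ?_⟩
    rw [h₁, h₂]
    module

theorem ee_Aw (a b : ℝ) (z : Fin 4 → ℝ) : ee (Aw a b z) = Aw a b (ee z) := by
  ext i; fin_cases i <;> simp [ee, Aw] <;> ring

theorem vv_Aw (a b : ℝ) (z : Fin 4 → ℝ) : vv (Aw a b z) = Aw a b (vv z) := by
  ext i; fin_cases i <;> simp [vv, Aw] <;> ring

/-- If `(p + q i) (x + y i) = 0` and `x + y i ≠ 0`, then `p + q i = 0`. -/
theorem eq_zero_of_complex_mul_eq_zero {p q x y : ℝ} (hxy : (x, y) ≠ ((0 : ℝ), (0 : ℝ)))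
    (h₁ : p * x - q * y = 0) (h₂ : p * y + q * x = 0) : p = 0 ∧ q = 0 := by
  have hN : x ^ 2 + y ^ 2 ≠ 0 := by
    intro h
    exact hxy (Prod.ext (by nlinarith [sq_nonneg x, sq_nonneg y])
      (by nlinarith [sq_nonneg x, sq_nonneg y]))
  constructor
  · exact (mul_eq_zero.mp (show p * (x ^ 2 + y ^ 2) = 0 by
      linear_combination x * h₁ + y * h₂)).resolve_right hN
  · exact (mul_eq_zero.mp (show q * (x ^ 2 + y ^ 2) = 0 by
      linear_combination x * h₂ - y * h₁)).resolve_right hN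

theorem sharpIm_inter_vert {z : Fin 4 → ℝ} (hz : z ≠ 0)
    (h₀ : (z 0, z 1) ≠ ((0 : ℝ), (0 : ℝ))) (h₁ : (z 2, z 3) ≠ ((0 : ℝ), (0 : ℝ))) :
    sharpIm z ∩ vert z = {0} := by
  ext u
  rw [Set.mem_inter_iff, mem_sharpIm_iff hz, Set.mem_singleton_iff]
  constructor
  · rintro ⟨⟨α, β, rfl⟩, c, d, h⟩
    have e₀ := congrFun h 0
    have e₁ := congrFun h 1
    have e₂ := congrFun h 2
    have e₃ := congrFun h 3
    simp [ee, vv, Ep, Vp] at e₀ e₁ e₂ e₃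
    obtain ⟨hp, hq⟩ := eq_zero_of_complex_mul_eq_zero (p := α - c) (q := β - d) h₀
      (by linear_combination e₀) (by linear_combination e₁)
    obtain ⟨hp', hq'⟩ := eq_zero_of_complex_mul_eq_zero (p := α + c) (q := β + d) h₁
      (by linear_combination -e₂) (by linear_combination -e₃)
    have hα : α = 0 := by linarith
    have hβ : β = 0 := by linarith
    simp [hα, hβ]
  · rintro rfl
    exact ⟨⟨0, 0, by simp⟩, 0, 0, by simp⟩

theorem sharpIm_eq_vert_of_fst_eq_zero {z : Fin 4 → ℝ} (hz : z ≠ 0)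
    (h₀ : z 0 = 0) (h₁ : z 1 = 0) : sharpIm z = vert z := by
  have he : ee z = -Ep z := by ext i; fin_cases i <;> simp [ee, Ep, h₀, h₁]
  have hv : vv z = -Vp z := by ext i; fin_cases i <;> simp [vv, Vp, h₀, h₁]
  ext u
  rw [mem_sharpIm_iff hz, he, hv]
  constructor
  · rintro ⟨α, β, rfl⟩
    exact ⟨-α, -β, by module⟩
  · rintro ⟨c, d, rfl⟩
    exact ⟨-c, -d, by module⟩

theorem sharpIm_eq_vert_of_snd_eq_zero {z : Fin 4 → ℝ} (hz : z ≠ 0)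
    (h₂ : z 2 = 0) (h₃ : z 3 = 0) : sharpIm z = vert z := by
  have he : ee z = Ep z := by ext i; fin_cases i <;> simp [ee, Ep, h₂, h₃]
  have hv : vv z = Vp z := by ext i; fin_cases i <;> simp [vv, Vp, h₂, h₃]
  ext u
  rw [mem_sharpIm_iff hz, he, hv]
  rfl

/-- `π_Σ = ¼(𝓔₀-𝓔₁)∧(𝓥₀-𝓥₁)` on `ℂ²∖{0}` is invariant under the scalar
`ℂˣ`-action, and at a point `(z₀,z₁)`: if `z₀z₁ ≠ 0` then `Im π_Σ^♯ ∩ V = 0`, while if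
exactly one of `z₀, z₁` vanishes then `Im π_Σ^♯ = V`. -/
theorem stmt17 :
    -- invariance: (A_w)_* π_{Σ,z} = π_{Σ, A_w z} for w ≠ 0, z ≠ 0
    (∀ a b : ℝ, (a, b) ≠ ((0 : ℝ), (0 : ℝ)) → ∀ z : Fin 4 → ℝ, z ≠ 0 →
      ∀ ξ η : (Fin 4 → ℝ) →ₗ[ℝ] ℝ,
        (1/4) * (ξ (ee (Aw a b z)) * η (vv (Aw a b z))
               - ξ (vv (Aw a b z)) * η (ee (Aw a b z)))
        = (1/4) * (ξ (Aw a b (ee z)) * η (Aw a b (vv z))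
                 - ξ (Aw a b (vv z)) * η (Aw a b (ee z))))
    ∧
    (∀ z : Fin 4 → ℝ, z ≠ 0 →
      (((z 0, z 1) ≠ ((0 : ℝ), (0 : ℝ)) ∧ (z 2, z 3) ≠ ((0 : ℝ), (0 : ℝ))) →
        sharpIm z ∩ vert z = {0})
      ∧
      ((((z 0, z 1) = ((0 : ℝ), (0 : ℝ)) ∧ (z 2, z 3) ≠ ((0 : ℝ), (0 : ℝ))) ∨
        ((z 0, z 1) ≠ ((0 : ℝ), (0 : ℝ)) ∧ (z 2, z 3) = ((0 : ℝ), (0 : ℝ)))) →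
        sharpIm z = vert z)) := by
  refine ⟨fun a b _ z _ ξ η => by rw [ee_Aw, vv_Aw], fun z hz =>
    ⟨fun h => sharpIm_inter_vert hz h.1 h.2, ?_⟩⟩
  rintro (⟨h, -⟩ | ⟨-, h⟩)
  · exact sharpIm_eq_vert_of_fst_eq_zero hz (Prod.ext_iff.mp h).1 (Prod.ext_iff.mp h).2
  · exact sharpIm_eq_vert_of_snd_eq_zero hz (Prod.ext_iff.mp h).1 (Prod.ext_iff.mp h).2

end
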